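/- arXiv:1101.0142 — 3 statements merged into one kernel-verified Lean document; each statement's English description precedes it below -/
import Mathlib

section
/- Let u_0 and r be coprime positive integers with r ≥ 2, set u_k := u_0 + k·r, and let n ≥ 0 and 0 ≤ k ≤ n be integers. Then L_n := lcm(u_0, …, u_n) satisfies L_n ≥ r^{(n−k)·r/(r−1)} · binom(u_{k−1}/r + (n−k+1), n−k+1), where u_{k−1} := u_0 + (k−1)·r (so u_{k−1}/r may be a rational number) and binom(x, m) := x(x−1)⋯(x−m+1)/m! denotes the generalized binomial coefficient for a real number x and nonnegative integer m. -/
/-- The generalized binomial coefficient `binom(x, m) = x(x-1)⋯(x-m+1)/m!`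
for a real number `x` and a nonnegative integer `m`. -/
noncomputable def genBinom (x : ℝ) (m : ℕ) : ℝ :=
  (descPochhammer ℝ m).eval x / (m.factorial : ℝ)

/-- If `L` is a common multiple of the terms of an arithmetic progression of length `m + 1` and
common difference `r`, their product divides `L * (m! * r ^ m)`. -/
theorem prod_arith_dvd_mul_factorial_mul_pow (r L m u : ℕ)
    (h : ∀ j ≤ m, u + j * r ∣ L) :
    ∏ j ∈ Finset.range (m + 1), (u + j * r) ∣ L * (m.factorial * r ^ m) := by
  induction m generalizing u with
  | zero => simpa using h 0 le_rfl
  | succ m ih =>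
    have hlast := mul_dvd_mul_right (ih u fun j hj => h j (by omega)) (u + (m + 1) * r)
    rw [← Finset.prod_range_succ] at hlast
    have hfirst := mul_dvd_mul_right
      (ih (u + r) fun j hj => by
        have := h (j + 1) (by omega)
        rwa [add_mul, one_mul, add_comm (j * r), ← add_assoc] at this) u
    have hprod : (∏ j ∈ Finset.range (m + 1), (u + r + j * r)) * u =
        ∏ j ∈ Finset.range (m + 1 + 1), (u + j * r) := by
      rw [Finset.prod_range_succ' _ (m + 1)]
      congr 1
      · exact Finset.prod_congr rfl fun j _ => by ring
      · simp
    rw [hprod] at hfirst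
    have hdiff := Nat.dvd_sub hlast hfirst
    rwa [← Nat.mul_sub, Nat.add_sub_cancel_left,
      show L * (m.factorial * r ^ m) * ((m + 1) * r) =
        L * ((m + 1).factorial * r ^ (m + 1)) by rw [Nat.factorial_succ]; ring] at hdiff

/-- If `L` is a common multiple of the terms of an arithmetic progression of length `m + 1` whose
common difference `r` is coprime to the first term, then powers of `r` dividing `m!` improve the
lower bound `(product of the terms) / m!` for `L`. -/
theorem prod_arith_mul_pow_le_mul_factorial {r L m u e : ℕ} (hcop : Nat.Coprime u r)
    (hL : 0 < L) (h : ∀ j ≤ m, u + j * r ∣ L) (he : r ^ e ∣ m.factorial) :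
    (∏ j ∈ Finset.range (m + 1), (u + j * r)) * r ^ e ≤ L * m.factorial := by
  obtain ⟨f, hf⟩ := he
  have hfpos : 0 < f := Nat.pos_of_ne_zero fun h0 => m.factorial_ne_zero (by simp [hf, h0])
  have hprod : Nat.Coprime (∏ j ∈ Finset.range (m + 1), (u + j * r)) (r ^ (e + m)) :=
    Nat.Coprime.pow_right _ (Nat.Coprime.prod_left fun j _ => by simpa using hcop)
  have hdvd := prod_arith_dvd_mul_factorial_mul_pow r L m u h
  rw [hf, show L * (r ^ e * f * r ^ m) = L * f * r ^ (e + m) by ring] at hdvd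
  calc _ ≤ L * f * r ^ e :=
        Nat.mul_le_mul_right _ (Nat.le_of_dvd (by positivity) (hprod.dvd_of_dvd_mul_right hdvd))
    _ = L * m.factorial := by rw [hf]; ring

theorem pow_mul_factorial_dvd_factorial_mul {r : ℕ} (hr : 0 < r) (q : ℕ) :
    r ^ q * q.factorial ∣ (r * q).factorial := by
  induction q with
  | zero => simp
  | succ q ih =>
    obtain ⟨s, rfl⟩ : ∃ s, r = s + 1 := ⟨r - 1, by omega⟩
    have hfac : ((s + 1) * (q + 1)).factorial =
        (s + 1) * (q + 1) * ((s + 1) * q + s).factorial := by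
      rw [show (s + 1) * (q + 1) = (s + 1) * q + s + 1 by ring, Nat.factorial_succ]
    rw [hfac, Nat.factorial_succ,
      show (s + 1) ^ (q + 1) * ((q + 1) * q.factorial) =
        (s + 1) * (q + 1) * ((s + 1) ^ q * q.factorial) by ring]
    exact mul_dvd_mul_left _ (ih.trans (Nat.factorial_dvd_factorial (by omega)))

/-- Legendre-type estimate: some power of `r` dividing `m!` is at least `r^{m/(r-1)} / (m+1)`. -/
theorem exists_pow_dvd_factorial_rpow_le {r : ℕ} (hr : 2 ≤ r) (m : ℕ) :
    ∃ e : ℕ, r ^ e ∣ m.factorial ∧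
      (r : ℝ) ^ ((m : ℝ) / ((r : ℝ) - 1)) ≤ ((m : ℝ) + 1) * (r : ℝ) ^ e := by
  induction m using Nat.strong_induction_on with
  | _ m ih =>
    rcases Nat.eq_zero_or_pos m with rfl | hm
    · exact ⟨0, by simp⟩
    set q := m / r
    set t := m % r
    have hqt : r * q + t = m := Nat.div_add_mod m r
    have ht : t + 1 ≤ r := Nat.mod_lt m (by omega)
    obtain ⟨e, he, hle⟩ := ih q (Nat.div_lt_self hm hr)
    refine ⟨q + e, ?_, ?_⟩
    · rw [pow_add]
      exact (mul_dvd_mul_left _ he).trans ((pow_mul_factorial_dvd_factorial_mul (by omega) q).trans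
        (Nat.factorial_dvd_factorial (by omega)))
    have hr' : (2 : ℝ) ≤ r := by exact_mod_cast hr
    have hr0 : (0 : ℝ) < r := by linarith
    have hr1 : (0 : ℝ) < (r : ℝ) - 1 := by linarith
    have ht' : (t : ℝ) + 1 ≤ r := by exact_mod_cast ht
    have hm' : (m : ℝ) = r * q + t := by exact_mod_cast hqt.symm
    have hexp : (m : ℝ) / ((r : ℝ) - 1) = q + q / ((r : ℝ) - 1) + t / ((r : ℝ) - 1) := by
      rw [hm']; field_simp; ring
    have hbern : (r : ℝ) ^ ((t : ℝ) / ((r : ℝ) - 1)) ≤ 1 + t := by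
      have := rpow_one_add_le_one_add_mul_self (s := (r : ℝ) - 1) (by linarith)
        (p := (t : ℝ) / ((r : ℝ) - 1)) (by positivity) ((div_le_one hr1).2 (by linarith))
      rwa [add_sub_cancel, div_mul_cancel₀ _ hr1.ne'] at this
    have hlin : ((q : ℝ) + 1) * (1 + t) ≤ m + 1 := by
      rw [hm']
      nlinarith [mul_nonneg (Nat.cast_nonneg (α := ℝ) q) (sub_nonneg.2 ht')]
    rw [hexp, Real.rpow_add hr0, Real.rpow_add hr0, Real.rpow_natCast]
    calc _ ≤ (r : ℝ) ^ q * (((q : ℝ) + 1) * (r : ℝ) ^ e) * (1 + t) := by gcongr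
      _ = ((q : ℝ) + 1) * (1 + t) * (r : ℝ) ^ (q + e) := by ring
      _ ≤ _ := by gcongr

theorem genBinom_div_add_eq_prod_div {r : ℝ} (hr : r ≠ 0) (u : ℝ) (m : ℕ) :
    genBinom ((u - r) / r + (m + 1)) (m + 1) =
      (∏ j ∈ Finset.range (m + 1), (u + j * r)) / (r ^ (m + 1) * (m + 1).factorial) := by
  have hprod : (descPochhammer ℝ (m + 1)).eval ((u - r) / r + (m + 1)) =
      (∏ j ∈ Finset.range (m + 1), (u + j * r)) / r ^ (m + 1) := by
    rw [descPochhammer_eval_eq_prod_range, ← Finset.prod_range_reflect]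
    have hpow : r ^ (m + 1) = ∏ _j ∈ Finset.range (m + 1), r := by simp
    rw [hpow, ← Finset.prod_div_distrib]
    refine Finset.prod_congr rfl fun j hj => ?_
    have hjm : j ≤ m := by simpa [Nat.lt_succ_iff] using hj
    rw [show m + 1 - 1 - j = m - j by omega, Nat.cast_sub hjm]
    field_simp
    ring
  rw [genBinom, hprod, div_div]

/-- Corollary 3.3: for coprime positive integers `u₀` and `r` with `r ≥ 2`,
`u_j = u₀ + j·r` (allowing `j = k - 1`, possibly negative index), and
`0 ≤ k ≤ n`,
`L_n ≥ r^{(n-k)·r/(r-1)} · binom(u_{k-1}/r + (n-k+1), n-k+1)`. -/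
theorem lcm_bound_stmt5 (u0 r : ℕ) (hu0 : 0 < u0) (hr : 2 ≤ r)
    (hcop : Nat.Coprime u0 r) (n k : ℕ) (hk : k ≤ n) :
    ((Finset.lcm (Finset.range (n + 1)) (fun j => u0 + j * r) : ℕ) : ℝ) ≥
      (r : ℝ) ^ (((n - k : ℕ) : ℝ) * (r : ℝ) / ((r : ℝ) - 1)) *
        genBinom (((u0 : ℝ) + ((k : ℝ) - 1) * (r : ℝ)) / (r : ℝ) + (((n - k : ℕ) : ℝ) + 1))
          (n - k + 1) := by
  obtain ⟨m, rfl⟩ := Nat.exists_eq_add_of_le hk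
  rw [Nat.add_sub_cancel_left]
  set L := Finset.lcm (Finset.range (k + m + 1)) (fun j => u0 + j * r)
  have hL : 0 < L := Nat.pos_of_ne_zero fun h0 => by
    obtain ⟨j, -, hj⟩ := Finset.lcm_eq_zero_iff.1 h0
    have : u0 + j * r = 0 := hj
    omega
  have hdvd : ∀ j ≤ m, u0 + k * r + j * r ∣ L := fun j hj => by
    have := Finset.dvd_lcm (f := fun j => u0 + j * r)
      (Finset.mem_range.2 (show k + j < k + m + 1 by omega))
    simpa only [add_mul, ← add_assoc] using this
  obtain ⟨e, he, hle⟩ := exists_pow_dvd_factorial_rpow_le hr m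
  have hbound := prod_arith_mul_pow_le_mul_factorial (u := u0 + k * r) (by simpa using hcop)
    hL hdvd he
  have hr' : (2 : ℝ) ≤ r := by exact_mod_cast hr
  have hr0 : (0 : ℝ) < r := by linarith
  have hr1 : (r : ℝ) - 1 ≠ 0 := by linarith
  rw [show (u0 : ℝ) + ((k : ℝ) - 1) * r = (u0 + k * r) - r by ring,
    genBinom_div_add_eq_prod_div hr0.ne',
    show (m : ℝ) * r / ((r : ℝ) - 1) = m + m / ((r : ℝ) - 1) by field_simp; ring,
    Real.rpow_add hr0, Real.rpow_natCast]
  set P : ℝ := ∏ j ∈ Finset.range (m + 1), ((u0 : ℝ) + k * r + j * r) with hP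
  have hP0 : 0 ≤ P := by positivity
  have hbound' : P * (r : ℝ) ^ e ≤ L * m.factorial := by
    rw [hP]; exact_mod_cast hbound
  have hfac : (0 : ℝ) < m.factorial := by positivity
  calc (r : ℝ) ^ m * (r : ℝ) ^ ((m : ℝ) / ((r : ℝ) - 1)) *
        (P / ((r : ℝ) ^ (m + 1) * (m + 1).factorial))
      ≤ (r : ℝ) ^ m * (((m : ℝ) + 1) * (r : ℝ) ^ e) *
        (P / ((r : ℝ) ^ (m + 1) * (m + 1).factorial)) := by gcongr
    _ = P * (r : ℝ) ^ e / m.factorial / r := by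
        rw [Nat.factorial_succ]; push_cast; field_simp; ring
    _ ≤ L / r := by
        gcongr
        exact (div_le_iff₀ hfac).2 hbound'
    _ ≤ L := div_le_self (by positivity) (by linarith)
end

section
/- Let a ≥ 2 and ℓ ≥ 2 be integers, let α ≥ a and r ≥ max(a, ℓ−1) be integers, let u_0 be a positive integer coprime to r, set u_k := u_0 + k·r, and let n ≥ ℓ·α·r be an integer. Then L_n := lcm(u_0, …, u_n) satisfies L_n ≥ u_0 · r^{(ℓ−1)·α + a − ℓ} · (r+1)^n. -/
open Finset in
/-- A common multiple of `m + 1` consecutive terms of an arithmetic progression of difference `r`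
is divisible by their product, up to the factor `m! * r ^ m`. -/
theorem prod_arith_dvd_factorial_mul_pow_mul (u r m k L : ℕ)
    (hL : ∀ i ∈ range (m + 1), u + (k + i) * r ∣ L) :
    ∏ i ∈ range (m + 1), (u + (k + i) * r) ∣ m.factorial * r ^ m * L := by
  induction m generalizing k with
  | zero => simpa using hL 0 (by simp)
  | succ m ih =>
    have h_init := ih k fun i hi => hL i (by simp at hi ⊢; omega)
    have h_tail := ih (k + 1) fun i hi => by
      have := hL (i + 1) (by simp at hi ⊢; omega)
      rwa [show k + (i + 1) = k + 1 + i by ring] at this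
    have h_last := mul_dvd_mul_right h_init (u + (k + (m + 1)) * r)
    have h_first := mul_dvd_mul_right h_tail (u + k * r)
    rw [← prod_range_succ (fun i => u + (k + i) * r)] at h_last
    have h_prod : (∏ i ∈ range (m + 1), (u + (k + 1 + i) * r)) * (u + k * r) =
        ∏ i ∈ range (m + 1 + 1), (u + (k + i) * r) := by
      rw [prod_range_succ' _ (m + 1)]
      congr 1
      exact prod_congr rfl fun i _ => by ring
    rw [h_prod] at h_first
    refine (Nat.dvd_add_right h_first).1 ?_
    rwa [show m.factorial * r ^ m * L * (u + k * r) + (m + 1).factorial * r ^ (m + 1) * L =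
      m.factorial * r ^ m * L * (u + (k + (m + 1)) * r) by rw [Nat.factorial_succ]; ring]

open Finset in
/-- If `r` is coprime to `u`, any power of `r` dividing `m!` can be gained in the lower bound for a
common multiple of `m + 1` consecutive terms `u + i * r`. -/
theorem prod_arith_mul_pow_le_factorial_mul {u r m k L e : ℕ} (hcop : Nat.Coprime u r)
    (hL0 : 0 < L) (hL : ∀ i ∈ range (m + 1), u + (k + i) * r ∣ L)
    (he : r ^ e ∣ m.factorial) :
    (∏ i ∈ range (m + 1), (u + (k + i) * r)) * r ^ e ≤ m.factorial * L := by
  have h := prod_arith_dvd_factorial_mul_pow_mul u r m k L hL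
  have hc : Nat.Coprime (∏ i ∈ range (m + 1), (u + (k + i) * r)) r :=
    Nat.Coprime.prod_left fun i _ => by simpa using hcop
  obtain ⟨q, hq⟩ := he
  have hq0 : 0 < q := Nat.pos_of_ne_zero fun h0 => m.factorial_ne_zero (by simp [hq, h0])
  rw [hq, show r ^ e * q * r ^ m * L = r ^ (e + m) * (q * L) by ring] at h
  have hle := Nat.le_of_dvd (by positivity) ((hc.pow_right (e + m)).dvd_of_dvd_mul_left h)
  calc _ ≤ q * L * r ^ e := Nat.mul_le_mul_right _ hle
    _ = _ := by rw [hq]; ring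

open Finset in
/-- Among the final segments `u_k, …, u_n` of `u_i = u + i * r`, one has product at least
`u * (r + 1) ^ n * (n - k)!`, with `k` at most about `n / (r + 1)`. -/
theorem exists_le_prod_arith (u r n : ℕ) (hu : 0 < u) :
    ∃ k m, k + m = n ∧ r * k ≤ m + r ∧ n + 1 ≤ u + (r + 1) * k ∧
      u * (r + 1) ^ n * m.factorial ≤ ∏ i ∈ range (m + 1), (u + (k + i) * r) := by
  induction n with
  | zero => exact ⟨0, 0, by simp; omega⟩
  | succ n ih =>
    obtain ⟨k, m, rfl, h_le, h_lt, h_prod⟩ := ih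
    have h_new : (r + 1) * (m + 1) ≤ u + (k + (m + 1)) * r := by nlinarith
    have h_step : u * (r + 1) ^ (k + m + 1) * (m + 1).factorial ≤
        ∏ i ∈ range (m + 1 + 1), (u + (k + i) * r) := by
      rw [prod_range_succ _ (m + 1), Nat.factorial_succ]
      calc _ = u * (r + 1) ^ (k + m) * m.factorial * ((r + 1) * (m + 1)) := by ring
        _ ≤ _ := Nat.mul_le_mul h_prod h_new
    by_cases hk : (r + 1) * k + u ≤ k + m + 1
    · refine ⟨k + 1, m, by ring, by nlinarith, by nlinarith, ?_⟩
      have h_first : u + k * r ≤ m + 1 := by nlinarith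
      refine Nat.le_of_mul_le_mul_right ?_ (show 0 < u + k * r by omega)
      calc _ ≤ u * (r + 1) ^ (k + m + 1) * m.factorial * (m + 1) := Nat.mul_le_mul_left _ h_first
        _ = u * (r + 1) ^ (k + m + 1) * (m + 1).factorial := by rw [Nat.factorial_succ]; ring
        _ ≤ _ := h_step
        _ = _ := by
          rw [prod_range_succ' _ (m + 1)]
          congr 1
          exact prod_congr rfl fun i _ => by ring
    · exact ⟨k, m + 1, by ring, by omega, by omega, h_step⟩

theorem Nat.pow_dvd_factorial_of_mul_le {r e m : ℕ} (hr : 0 < r) (h : e * r ≤ m) :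
    r ^ e ∣ m.factorial := by
  have h1 := Nat.prod_factorial_dvd_factorial_sum (Finset.range e) fun _ => r
  simp only [Finset.prod_const, Finset.sum_const, Finset.card_range, smul_eq_mul] at h1
  exact ((pow_dvd_pow_of_dvd (Nat.dvd_factorial hr le_rfl) e).trans h1).trans
    (Nat.factorial_dvd_factorial h)

theorem exponent_mul_succ_lt {a l α r : ℕ} (hl : 2 ≤ l) (hα : a ≤ α) (hra : a ≤ r)
    (hrl : l - 1 ≤ r) : ((l - 1) * α + a - l) * (r + 1) < l * α * r ∨
      (l - 1) * α + a - l = 0 := by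
  obtain ⟨l, rfl⟩ : ∃ t, l = t + 1 := ⟨l - 1, by omega⟩
  rw [Nat.add_sub_cancel] at *
  rcases Nat.eq_zero_or_pos (l * α + a - (l + 1)) with h0 | h0
  · exact .inr h0
  left
  generalize hE : l * α + a - (l + 1) = E at *
  have hE' : E + (l + 1) = l * α + a := by omega
  obtain ⟨b, rfl⟩ := Nat.exists_eq_add_of_le hα
  obtain ⟨c, rfl⟩ := Nat.exists_eq_add_of_le hra
  obtain ⟨d, hd⟩ := Nat.exists_eq_add_of_le hrl
  zify at *
  have hb : (0 : ℤ) ≤ b * d := by positivity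
  have hc : (0 : ℤ) ≤ (l + 1) * c := by positivity
  have hEq : (E : ℤ) = l * (a + b) + a - (l + 1) := by linarith
  have hdd : (d : ℤ) = a + c - l := by linarith
  rw [hdd] at hb
  rw [hEq]
  nlinarith

/-- Theorem of Tan and Hong: for integers `a, ℓ ≥ 2`, `α ≥ a`,
`r ≥ max(a, ℓ-1)`, a positive integer `u₀` coprime to `r`,
`u_k = u₀ + k·r`, and `n ≥ ℓ·α·r`,
`L_n ≥ u₀ · r^{(ℓ-1)·α + a - ℓ} · (r+1)^n`. -/
theorem lcm_bound_stmt6 (a l α r u0 n : ℕ) (ha : 2 ≤ a) (hl : 2 ≤ l)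
    (hα : a ≤ α) (hra : a ≤ r) (hrl : l - 1 ≤ r) (hu0 : 0 < u0)
    (hcop : Nat.Coprime u0 r) (hn : l * α * r ≤ n) :
    u0 * r ^ ((l - 1) * α + a - l) * (r + 1) ^ n ≤
      Finset.lcm (Finset.range (n + 1)) (fun k => u0 + k * r) := by
  obtain ⟨k, m, rfl, h_le, -, h_prod⟩ := exists_le_prod_arith u0 r n hu0
  have hr : 0 < r := by omega
  set e := (l - 1) * α + a - l with he
  have hem : e * r ≤ m := by
    rcases exponent_mul_succ_lt hl hα hra hrl with h | h
    · rw [← he] at h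
      have h1 : e * (r + 1) + 1 ≤ k + m := by omega
      have h2 := Nat.mul_le_mul_left r h1
      refine Nat.le_of_mul_le_mul_right (c := r + 1) ?_ r.succ_pos
      nlinarith
    · simp [he, h]
  set L := Finset.lcm (Finset.range (k + m + 1)) (fun k => u0 + k * r) with hL
  have hL0 : 0 < L := Nat.pos_of_ne_zero fun h0 => by
    rw [hL, Finset.lcm_eq_zero_iff] at h0
    obtain ⟨i, -, hi⟩ := h0
    omega
  have hmul := prod_arith_mul_pow_le_factorial_mul (k := k) hcop hL0
    (fun i hi => Finset.dvd_lcm (f := fun k => u0 + k * r) (by simp at hi ⊢; omega))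
    (Nat.pow_dvd_factorial_of_mul_le hr hem)
  refine Nat.le_of_mul_le_mul_left ?_ m.factorial_pos
  calc _ = u0 * (r + 1) ^ (k + m) * m.factorial * r ^ e := by ring
    _ ≤ _ := Nat.mul_le_mul_right _ h_prod
    _ ≤ _ := hmul
end

section
/- Let u_0 and r be coprime positive integers with r ≥ 2, set u_k := u_0 + k·r, and let n ≥ 0 be an integer. Then L_n := lcm(u_0, …, u_n) satisfies L_n ≥ r^{n·r/(r−1)} · binom(u_0/r + n, n+1), where binom(x, m) := x(x−1)⋯(x−m+1)/m! denotes the generalized binomial coefficient for a real number x and nonnegative integer m. -/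
/-- A common multiple `L` of the terms `a, a + r, …, a + n * r` satisfies
`∏ (a + k * r) ∣ L * (n! * r ^ n)`. -/
theorem prod_arith_prog_dvd (r L : ℤ) (n : ℕ) (a : ℤ)
    (h : ∀ k ∈ Finset.range (n + 1), a + k * r ∣ L) :
    ∏ k ∈ Finset.range (n + 1), (a + k * r) ∣ L * (n.factorial * r ^ n) := by
  induction n generalizing a with
  | zero => simpa using h
  | succ n ih =>
    obtain ⟨A, hA⟩ := ih a fun k hk => h k (by simp at hk ⊢; omega)
    obtain ⟨B, hB⟩ := ih (a + r) fun k hk => by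
      have := h (k + 1) (by simp at hk ⊢; omega)
      push_cast at this
      convert this using 1
      ring
    have hP := Finset.prod_range_succ (fun k : ℕ => a + (k : ℤ) * r) (n + 1)
    have hP' := Finset.prod_range_succ' (fun k : ℕ => a + (k : ℤ) * r) (n + 1)
    have hshift : ∏ k ∈ Finset.range (n + 1), (a + ((k + 1 : ℕ) : ℤ) * r) =
        ∏ k ∈ Finset.range (n + 1), (a + r + (k : ℤ) * r) :=
      Finset.prod_congr rfl fun k _ => by push_cast; ring
    rw [hshift] at hP'
    refine ⟨A - B, ?_⟩
    rw [Nat.factorial_succ]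
    push_cast at hP hP' ⊢
    linear_combination (a + (n + 1) * r) * hA - a * hB - A * hP + B * hP'

/-- Some power `r ^ e` dividing `n!` satisfies `r ^ n ≤ (r ^ e * (r * n)) ^ (r - 1)`. -/
theorem exists_pow_dvd_factorial {r : ℕ} (hr : 2 ≤ r) (n : ℕ) (hn : 0 < n) :
    ∃ e, r ^ e ∣ n.factorial ∧ r ^ n ≤ (r ^ e * (r * n)) ^ (r - 1) := by
  induction n using Nat.strong_induction_on with
  | _ n ih =>
  rcases lt_or_ge n r with hlt | hge
  · refine ⟨0, by simp, ?_⟩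
    calc r ^ n ≤ r ^ (r - 1) := Nat.pow_le_pow_right (by omega) (by omega)
      _ ≤ _ := Nat.pow_le_pow_left (by nlinarith) _
  · have hq : 0 < n / r := Nat.div_pos hge (by omega)
    obtain ⟨e, hdvd, hle⟩ := ih (n / r) (Nat.div_lt_self hn hr) hq
    have hmod : n % r ≤ r - 1 := by
      have := Nat.mod_lt n (show 0 < r by omega)
      omega
    have hmul : r * (n / r) ≤ n := Nat.mul_div_le n r
    refine ⟨n / r + e, ?_, ?_⟩
    · have hfac : r ^ (n / r) * (n / r).factorial ∣ (r * (n / r)).factorial := by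
        generalize n / r = q
        induction q with
        | zero => simp
        | succ q ihq =>
          have h1 : (r * q).factorial * (r * (q + 1)) ∣ (r * (q + 1)).factorial := by
            obtain ⟨s, rfl⟩ : ∃ s, r = s + 1 := ⟨r - 1, by omega⟩
            rw [show (s + 1) * (q + 1) = ((s + 1) * q + s) + 1 by ring, Nat.factorial_succ,
              mul_comm]
            exact mul_dvd_mul_left _ (Nat.factorial_dvd_factorial (by omega))
          refine Dvd.dvd.trans ?_ h1
          rw [Nat.factorial_succ, pow_succ]
          convert mul_dvd_mul_right ihq (r * (q + 1)) using 1
          ring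
      rw [pow_add]
      exact (mul_dvd_mul_left _ hdvd).trans (hfac.trans (Nat.factorial_dvd_factorial hmul))
    · calc r ^ n = r ^ ((r - 1) * (n / r) + n / r + n % r) := by
            congr 1
            have h := Nat.div_add_mod n r
            obtain ⟨s, rfl⟩ : ∃ s, r = s + 1 := ⟨r - 1, by omega⟩
            rw [Nat.add_sub_cancel, ← Nat.succ_mul]
            exact h.symm
        _ = (r ^ (n / r)) ^ (r - 1) * r ^ (n / r) * r ^ (n % r) := by
            rw [pow_add, pow_add, ← pow_mul, mul_comm (r - 1)]
        _ ≤ (r ^ (n / r)) ^ (r - 1) * (r ^ e * (r * (n / r))) ^ (r - 1) * r ^ (r - 1) := by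
            gcongr
            omega
        _ = (r ^ (n / r + e) * (r * (r * (n / r)))) ^ (r - 1) := by
            rw [← mul_pow, ← mul_pow]
            ring
        _ ≤ _ := by gcongr

/-- For `u₀` coprime to `r` and `r ^ e ∣ n!`, the factor `r ^ e` can be saved in the divisibility
`∏ u_k ∣ lcm(u₀, …, u_n) * n!`. -/
theorem prod_mul_pow_dvd_lcm_mul_factorial {u0 r n e : ℕ} (hcop : Nat.Coprime u0 r)
    (he : r ^ e ∣ n.factorial) :
    (∏ k ∈ Finset.range (n + 1), (u0 + k * r)) * r ^ e ∣
      Finset.lcm (Finset.range (n + 1)) (fun k => u0 + k * r) * n.factorial := by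
  set L := Finset.lcm (Finset.range (n + 1)) (fun k => u0 + k * r) with hL
  have h : ∏ k ∈ Finset.range (n + 1), (u0 + k * r) ∣ L * (n.factorial * r ^ n) := by
    have := prod_arith_prog_dvd r L n u0 fun k hk => by
      exact_mod_cast Finset.dvd_lcm (f := fun k => u0 + k * r) hk
    exact_mod_cast this
  have hc : Nat.Coprime (∏ k ∈ Finset.range (n + 1), (u0 + k * r)) r :=
    Nat.Coprime.prod_left fun k _ => by simpa using hcop
  obtain ⟨m, hm⟩ := he
  rw [hm] at h ⊢
  rw [show L * (r ^ e * m * r ^ n) = L * m * r ^ (e + n) by ring] at h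
  rw [show L * (r ^ e * m) = L * m * r ^ e by ring]
  exact mul_dvd_mul_right ((hc.pow_right _).dvd_of_dvd_mul_right h) _

theorem genBinom_div_add {r : ℝ} (hr : r ≠ 0) (a : ℝ) (n : ℕ) :
    genBinom (a / r + n) (n + 1) =
      (∏ k ∈ Finset.range (n + 1), (a + k * r)) / (r ^ (n + 1) * (n + 1).factorial) := by
  have h : (descPochhammer ℝ (n + 1)).eval (a / r + n) =
      (∏ k ∈ Finset.range (n + 1), (a + k * r)) / r ^ (n + 1) := by
    rw [descPochhammer_eval_eq_prod_range, ← Finset.prod_range_reflect]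
    nth_rewrite 4 [← Finset.card_range (n + 1)]
    rw [← Finset.prod_const, ← Finset.prod_div_distrib]
    refine Finset.prod_congr rfl fun k hk => ?_
    have hk' : k ≤ n := by simp at hk; omega
    rw [show n + 1 - 1 - k = n - k by omega, Nat.cast_sub hk']
    field_simp
    ring
  rw [genBinom, h, div_div]

/-- Corollary 4.1: for coprime positive integers `u₀` and `r` with `r ≥ 2`,
`u_k = u₀ + k·r`, and `n ≥ 0`,
`L_n ≥ r^{n·r/(r-1)} · binom(u₀/r + n, n+1)`. -/
theorem lcm_bound_stmt7 (u0 r : ℕ) (hu0 : 0 < u0) (hr : 2 ≤ r)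
    (hcop : Nat.Coprime u0 r) (n : ℕ) :
    ((Finset.lcm (Finset.range (n + 1)) (fun k => u0 + k * r) : ℕ) : ℝ) ≥
      (r : ℝ) ^ ((n : ℝ) * (r : ℝ) / ((r : ℝ) - 1)) *
        genBinom ((u0 : ℝ) / (r : ℝ) + (n : ℝ)) (n + 1) := by
  have hr0 : (0 : ℝ) < r := by exact_mod_cast (by omega : 0 < r)
  have hr1 : (0 : ℝ) < (r : ℝ) - 1 := by
    have : (2 : ℝ) ≤ r := by exact_mod_cast hr
    linarith
  obtain ⟨e, hdvd, hle⟩ : ∃ e, r ^ e ∣ n.factorial ∧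
      r ^ n ≤ (r ^ e * (r * (n + 1))) ^ (r - 1) := by
    rcases Nat.eq_zero_or_pos n with rfl | hn
    · exact ⟨0, by simp, by simpa using Nat.one_le_pow _ _ (by omega)⟩
    · obtain ⟨e, h1, h2⟩ := exists_pow_dvd_factorial hr n hn
      exact ⟨e, h1, h2.trans (by gcongr; omega)⟩
  have hL : (∏ k ∈ Finset.range (n + 1), ((u0 : ℝ) + k * r)) * (r : ℝ) ^ e ≤
      (Finset.lcm (Finset.range (n + 1)) (fun k => u0 + k * r) : ℕ) * (n.factorial : ℝ) := by
    have hpos : 0 < Finset.lcm (Finset.range (n + 1)) (fun k => u0 + k * r) :=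
      Nat.pos_of_ne_zero fun h0 => by
        obtain ⟨k, -, hk⟩ := Finset.lcm_eq_zero_iff.mp h0
        omega
    exact_mod_cast Nat.le_of_dvd (Nat.mul_pos hpos n.factorial_pos)
      (prod_mul_pow_dvd_lcm_mul_factorial hcop hdvd)
  have hroot : (r : ℝ) ^ ((n : ℝ) / ((r : ℝ) - 1)) ≤ (r : ℝ) ^ e * (r * (n + 1)) := by
    have hcast : ((r - 1 : ℕ) : ℝ) = (r : ℝ) - 1 := by
      rw [Nat.cast_sub (by omega), Nat.cast_one]
    refine le_of_pow_le_pow_left₀ (n := r - 1) (by omega) (by positivity) ?_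
    rw [← Real.rpow_natCast, ← Real.rpow_mul hr0.le, hcast, div_mul_cancel₀ _ hr1.ne',
      Real.rpow_natCast]
    exact_mod_cast hle
  have hsplit : (r : ℝ) ^ ((n : ℝ) * r / ((r : ℝ) - 1)) =
      (r : ℝ) ^ n * (r : ℝ) ^ ((n : ℝ) / ((r : ℝ) - 1)) := by
    rw [← Real.rpow_natCast (r : ℝ) n, ← Real.rpow_add hr0]
    congr 1
    field_simp
    ring
  have hP : 0 ≤ ∏ k ∈ Finset.range (n + 1), ((u0 : ℝ) + k * r) := by positivity
  have hf : (0 : ℝ) < n.factorial := by exact_mod_cast n.factorial_pos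
  rw [ge_iff_le, genBinom_div_add hr0.ne', hsplit]
  calc _ ≤ (r : ℝ) ^ n * ((r : ℝ) ^ e * (r * (n + 1))) *
        ((∏ k ∈ Finset.range (n + 1), ((u0 : ℝ) + k * r)) /
          ((r : ℝ) ^ (n + 1) * (n + 1).factorial)) := by gcongr
    _ = (∏ k ∈ Finset.range (n + 1), ((u0 : ℝ) + k * r)) * (r : ℝ) ^ e / n.factorial := by
      rw [Nat.factorial_succ]
      push_cast
      field_simp
      ring
    _ ≤ _ := (div_le_iff₀ hf).mpr hL
end
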